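/- Let M be the 6×6 skew-symmetric matrix over R of type (f) with lᵢ = xᵢ, i.e., with rows (0, 0, 0, 0, x₀, x₁), (0, 0, 0, −x₀, 0, x₂), (0, 0, 0, −x₁, −x₂, 0), (0, x₀, x₁, 0, 0, 0), (−x₀, 0, x₂, 0, 0, 0), (−x₁, −x₂, 0, 0, 0, 0). Let M′ and M″ be 6×6 skew-symmetric matrices over R all of whose entries are linear forms, and write M′_{ij} = Σ_{k=0}^{4} a_{ijk}·x_k with a_{ijk} ∈ ℂ for 0 ≤ i < j ≤ 5. Let ℂ[u] be the polynomial ring in the variables u_{ijk} (0 ≤ i < j ≤ 5, 0 ≤ k ≤ 4), let Ñ₁ be the 3×2 matrix over ℂ[u] with rows (u₁₂₄, u₄₅₄), (u₀₂₄, u₃₅₄), (u₀₁₄, u₃₄₄), and Ñ₂ the 3×2 matrix with rows (u₁₂₃, u₄₅₃), (u₀₂₃, u₃₅₃), (u₀₁₃, u₃₄₃). Let I be the ideal of ℂ[u] generated by the 2×2 minors of the 3×4 matrix (Ñ₁ | Ñ₂) obtained by horizontal concatenation, and J the ideal generated by the 2×2 minors of the 6×2 matrix obtained by stacking Ñ₁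 on top of Ñ₂. If Pf(M + ε·M′ + ε²·M″) = 0 in R[ε]/(ε³), then every homogeneous polynomial of degree 2 lying in I ∩ J vanishes under the evaluation u_{ijk} ↦ a_{ijk}. -/

import Mathlib

open MvPolynomial Matrix

noncomputable section

/-- The polynomial ring `R = ℂ[x₀,…,x₄]`. -/
abbrev Rp : Type := MvPolynomial (Fin 5) ℂ

/-- The sub-Pfaffian `q_{αβ}(N)` of a `6 × 6` matrix: for `α < β` it is
`N_{ij}N_{kl} − N_{ik}N_{jl} + N_{il}N_{jk}` where `i < j < k < l` are the elements of
`{0,…,5} ∖ {α,β}`. -/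
def subPf {A : Type*} [CommRing A] (N : Matrix (Fin 6) (Fin 6) A) (α β : Fin 6) : A :=
  match (List.finRange 6).filter (fun i => decide (i ≠ α) && decide (i ≠ β)) with
  | [i, j, k, m] => N i j * N k m - N i k * N j m + N i m * N j k
  | _ => 0

/-- The Pfaffian of a `6 × 6` skew-symmetric matrix. -/
def pf {A : Type*} [CommRing A] (N : Matrix (Fin 6) (Fin 6) A) : A :=
  N 0 1 * subPf N 0 1 - N 0 2 * subPf N 0 2 + N 0 3 * subPf N 0 3
    - N 0 4 * subPf N 0 4 + N 0 5 * subPf N 0 5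

/-- The ring `R[ε]/(ε³)`. -/
abbrev Reps3 : Type := Polynomial Rp ⧸ Ideal.span {(Polynomial.X : Polynomial Rp) ^ 3}

/-- The matrix `M + ε M' + ε² M''` over `R[ε]/(ε³)`. -/
def jet2 (M M' M'' : Matrix (Fin 6) (Fin 6) Rp) : Matrix (Fin 6) (Fin 6) Reps3 :=
  Matrix.of fun i j =>
    Ideal.Quotient.mk _ (Polynomial.C (M i j) + Polynomial.C (M' i j) * Polynomial.X
      + Polynomial.C (M'' i j) * Polynomial.X ^ 2)

lemma pf_explicit {A : Type*} [CommRing A] (N : Matrix (Fin 6) (Fin 6) A) :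
    pf N = N 0 1 * (N 2 3 * N 4 5 - N 2 4 * N 3 5 + N 2 5 * N 3 4)
      - N 0 2 * (N 1 3 * N 4 5 - N 1 4 * N 3 5 + N 1 5 * N 3 4)
      + N 0 3 * (N 1 2 * N 4 5 - N 1 4 * N 2 5 + N 1 5 * N 2 4)
      - N 0 4 * (N 1 2 * N 3 5 - N 1 3 * N 2 5 + N 1 5 * N 2 3)
      + N 0 5 * (N 1 2 * N 3 4 - N 1 3 * N 2 4 + N 1 4 * N 2 3) := rfl

/-- The polynomial lift of `jet2`. -/
def jetPoly (M M' M'' : Matrix (Fin 6) (Fin 6) Rp) : Matrix (Fin 6) (Fin 6) (Polynomial Rp) :=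
  Matrix.of fun i j => Polynomial.C (M i j) + Polynomial.C (M' i j) * Polynomial.X
      + Polynomial.C (M'' i j) * Polynomial.X ^ 2

lemma jet_coeff (M M' M'' : Matrix (Fin 6) (Fin 6) Rp) (h : pf (jet2 M M' M'') = 0) (n : ℕ)
    (hn : n < 3) : (pf (jetPoly M M' M'')).coeff n = 0 := by
  have h1 : pf (jet2 M M' M'') =
      Ideal.Quotient.mk (Ideal.span {(Polynomial.X : Polynomial Rp) ^ 3})
        (pf (jetPoly M M' M'')) := by
    simp only [pf_explicit, map_add, map_sub, map_mul]
    rfl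
  rw [h1, Ideal.Quotient.eq_zero_iff_mem, Ideal.mem_span_singleton,
    Polynomial.X_pow_dvd_iff] at h
  exact h n hn

lemma coeff_one3 (f g h : Polynomial Rp) : (f * (g * h)).coeff 1 =
    f.coeff 1 * g.coeff 0 * h.coeff 0 + f.coeff 0 * g.coeff 1 * h.coeff 0
      + f.coeff 0 * g.coeff 0 * h.coeff 1 := by
  simp only [Polynomial.coeff_mul, Finset.Nat.antidiagonal_succ]
  simp [Finset.Nat.antidiagonal_succ]
  ring

lemma coeff_two3 (f g h : Polynomial Rp) : (f * (g * h)).coeff 2 =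
    f.coeff 2 * g.coeff 0 * h.coeff 0 + f.coeff 0 * g.coeff 2 * h.coeff 0
      + f.coeff 0 * g.coeff 0 * h.coeff 2
      + f.coeff 1 * g.coeff 1 * h.coeff 0 + f.coeff 1 * g.coeff 0 * h.coeff 1
      + f.coeff 0 * g.coeff 1 * h.coeff 1 := by
  simp only [Polynomial.coeff_mul, Finset.Nat.antidiagonal_succ]
  simp [Finset.Nat.antidiagonal_succ]
  ring

lemma jp0 (M M' M'' : Matrix (Fin 6) (Fin 6) Rp) (i j) :
    (jetPoly M M' M'' i j).coeff 0 = M i j := by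
  simp [jetPoly]
lemma jp1 (M M' M'' : Matrix (Fin 6) (Fin 6) Rp) (i j) :
    (jetPoly M M' M'' i j).coeff 1 = M' i j := by
  simp [jetPoly, Polynomial.coeff_C, Polynomial.coeff_X_pow]
lemma jp2 (M M' M'' : Matrix (Fin 6) (Fin 6) Rp) (i j) :
    (jetPoly M M' M'' i j).coeff 2 = M'' i j := by
  simp [jetPoly, Polynomial.coeff_X, Polynomial.coeff_C]

/-- The matrix of type (f). -/
def Mf : Matrix (Fin 6) (Fin 6) Rp := !![0, 0, 0, 0, X 0, X 1;
                 0, 0, 0, -X 0, 0, X 2;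
                 0, 0, 0, -X 1, -X 2, 0;
                 0, X 0, X 1, 0, 0, 0;
                 -X 0, 0, X 2, 0, 0, 0;
                 -X 1, -X 2, 0, 0, 0, 0]


lemma order_one (M' M'' : Matrix (Fin 6) (Fin 6) Rp) (h : pf (jet2 Mf M' M'') = 0) :
    X 2 ^ 2 * M' 0 3 + X 1 ^ 2 * M' 1 4 + X 0 ^ 2 * M' 2 5
      - X 1 * X 2 * (M' 0 4 + M' 1 3) + X 0 * X 2 * (M' 0 5 + M' 2 3)
      - X 0 * X 1 * (M' 1 5 + M' 2 4) = (0 : Rp) := by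
  have h1 := jet_coeff _ _ _ h 1 (by norm_num)
  simp only [pf_explicit, mul_add, mul_sub, Polynomial.coeff_add, Polynomial.coeff_sub,
    coeff_one3, jp0, jp1] at h1
  simp [Mf] at h1
  linear_combination -h1

lemma order_two (M' M'' : Matrix (Fin 6) (Fin 6) Rp) (h : pf (jet2 Mf M' M'') = 0) :
    X 0 * (M' 4 5 * M' 0 2 - M' 3 5 * M' 1 2 - M' 1 5 * M' 2 3 + M' 2 4 * M' 0 5
        - M' 0 4 * M' 2 5 + M' 2 5 * M' 1 3)
      + X 1 * (M' 3 4 * M' 1 2 - M' 0 1 * M' 4 5 + M' 1 5 * M' 0 4 - M' 2 4 * M' 1 3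
        + M' 2 3 * M' 1 4 - M' 0 5 * M' 1 4)
      + X 2 * (M' 0 1 * M' 3 5 - M' 0 2 * M' 3 4 - M' 0 3 * M' 1 5 + M' 0 3 * M' 2 4
        - M' 0 4 * M' 2 3 + M' 1 3 * M' 0 5)
      - (X 2 * (X 2 * M'' 0 3) + X 1 * (X 1 * M'' 1 4) + X 0 * (X 0 * M'' 2 5)
      - X 1 * (X 2 * (M'' 0 4 + M'' 1 3)) + X 0 * (X 2 * (M'' 0 5 + M'' 2 3))
      - X 0 * (X 1 * (M'' 1 5 + M'' 2 4))) = (0 : Rp) := by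
  have h1 := jet_coeff _ _ _ h 2 (by norm_num)
  simp only [pf_explicit, mul_add, mul_sub, Polynomial.coeff_add, Polynomial.coeff_sub,
    coeff_two3, jp0, jp1, jp2] at h1
  simp [Mf] at h1
  linear_combination h1

/-- Differentiating an element of the ideal `(x₀, x₁, x₂)` at a point where `x₀ = x₁ = x₂ = 0`. -/
lemma first_order (F G H K : Rp) (A B C D E L : Rp)
    (hK : K = X 2 * (X 2 * A) + X 1 * (X 1 * B) + X 0 * (X 0 * C)
      - X 1 * (X 2 * D) + X 0 * (X 2 * E) - X 0 * (X 1 * L))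
    (h : X 0 * F + X 1 * G + X 2 * H - K = 0) (s t : ℂ) :
    eval ![0, 0, 0, s, t] F = 0 ∧ eval ![0, 0, 0, s, t] G = 0 ∧ eval ![0, 0, 0, s, t] H = 0 := by
  subst hK
  refine ⟨?_, ?_, ?_⟩
  · have := congrArg (fun z => eval ![0, 0, 0, s, t] (pderiv 0 z)) h
    simpa [Derivation.leibniz, pderiv_X, Pi.single_apply] using this
  · have := congrArg (fun z => eval ![0, 0, 0, s, t] (pderiv 1 z)) h
    simpa [Derivation.leibniz, pderiv_X, Pi.single_apply] using this
  · have := congrArg (fun z => eval ![0, 0, 0, s, t] (pderiv 2 z)) h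
    simpa [Derivation.leibniz, pderiv_X, Pi.single_apply] using this

/-- A quadratic form with values in linear forms that vanishes identically has zero
coefficients at `x₃` and at `x₄`. -/
lemma quad_vanish (A B C D E F : Fin 5 → ℂ)
    (h : ∀ x : Fin 5 → ℂ, x 2 ^ 2 * ∑ k, A k * x k + x 1 ^ 2 * ∑ k, B k * x k
      + x 0 ^ 2 * ∑ k, C k * x k - x 1 * x 2 * ∑ k, D k * x k + x 0 * x 2 * ∑ k, E k * x k
      - x 0 * x 1 * ∑ k, F k * x k = 0) :
    ∀ k : Fin 5, 3 ≤ k → A k = 0 ∧ B k = 0 ∧ C k = 0 ∧ D k = 0 ∧ E k = 0 ∧ F k = 0 := by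
  simp only [Fin.sum_univ_five] at h
  have key : ∀ s t y0 y1 y2 : ℂ,
      y2 ^ 2 * (A 3 * s + A 4 * t) + y1 ^ 2 * (B 3 * s + B 4 * t) + y0 ^ 2 * (C 3 * s + C 4 * t)
      - y1 * y2 * (D 3 * s + D 4 * t) + y0 * y2 * (E 3 * s + E 4 * t)
      - y0 * y1 * (F 3 * s + F 4 * t) = 0 := by
    intro s t y0 y1 y2
    have h1 := h ![y0, y1, y2, s, t]
    have h2 := h ![y0, y1, y2, 0, 0]
    simp at h1 h2
    linear_combination h1 - h2
  have gen : ∀ a b c d e f : ℂ, (∀ y0 y1 y2 : ℂ, y2 ^ 2 * a + y1 ^ 2 * b + y0 ^ 2 * c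
      - y1 * y2 * d + y0 * y2 * e - y0 * y1 * f = 0) →
      a = 0 ∧ b = 0 ∧ c = 0 ∧ d = 0 ∧ e = 0 ∧ f = 0 := by
    intro a b c d e f hh
    have ha := hh 0 0 1
    have hb := hh 0 1 0
    have hc := hh 1 0 0
    have hd := hh 0 1 1
    have he := hh 1 0 1
    have hf := hh 1 1 0
    refine ⟨?_, ?_, ?_, ?_, ?_, ?_⟩
    · linear_combination ha
    · linear_combination hb
    · linear_combination hc
    · linear_combination ha + hb - hd
    · linear_combination he - ha - hc
    · linear_combination hb + hc - hf
  intro k hk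
  fin_cases k
  · exact absurd hk (by decide)
  · exact absurd hk (by decide)
  · exact absurd hk (by decide)
  · exact gen (A 3) (B 3) (C 3) (D 3) (E 3) (F 3) fun y0 y1 y2 => by
      linear_combination key 1 0 y0 y1 y2
  · exact gen (A 4) (B 4) (C 4) (D 4) (E 4) (F 4) fun y0 y1 y2 => by
      linear_combination key 0 1 y0 y1 y2

/-- The columns of the `3 × 4` matrix are pairwise proportional. -/
def RankI (p q r w : Fin 3 → ℂ) : Prop :=
  ∀ j₀ j₁ : Fin 4, ∀ i₀ i₁ : Fin 3,
    (![r, w, p, q] j₀) i₀ * (![r, w, p, q] j₁) i₁ = (![r, w, p, q] j₁) i₀ * (![r, w, p, q] j₀) i₁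

/-- The columns of the `6 × 2` matrix are proportional. -/
def RankJ (p q r w : Fin 3 → ℂ) : Prop :=
  ∀ i j, p i * q j = p j * q i ∧ r i * w j = r j * w i ∧ p i * w j = q i * r j

lemma rankI_of (p q r w n : Fin 3 → ℂ) (c₁ c₂ c₃ c₄ : ℂ) (hp : ∀ i, p i = c₁ * n i)
    (hq : ∀ i, q i = c₂ * n i) (hr : ∀ i, r i = c₃ * n i) (hw : ∀ i, w i = c₄ * n i) :
    RankI p q r w := by
  have hv : ∀ j i, (![r, w, p, q] j) i = (![c₃, c₄, c₁, c₂] j) * n i := by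
    intro j i
    fin_cases j
    · exact hr i
    · exact hw i
    · exact hp i
    · exact hq i
  intro j₀ j₁ i₀ i₁
  simp only [hv]
  ring

lemma dichotomy_aux (p q r w : Fin 3 → ℂ) (h₁ : ∀ i j, p i * q j = p j * q i)
    (h₂ : ∀ i j, r i * w j = r j * w i)
    (h₃ : ∀ i j, p i * w j - p j * w i + r i * q j - r j * q i = 0) (i : Fin 3) (hi : p i ≠ 0) :
    (∃ (n : Fin 3 → ℂ) (c₁ c₂ c₃ c₄ : ℂ), (∀ i, p i = c₁ * n i) ∧ (∀ i, q i = c₂ * n i) ∧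
      (∀ i, r i = c₃ * n i) ∧ (∀ i, w i = c₄ * n i)) ∨ RankJ p q r w := by
  obtain ⟨l, hl⟩ : ∃ l, ∀ j, q j = l * p j := by
    refine ⟨q i / p i, fun j => ?_⟩
    field_simp
    linear_combination h₁ i j
  obtain ⟨m, hm⟩ : ∃ m, ∀ j, w j = l * r j + m * p j := by
    refine ⟨(w i - l * r i) / p i, fun j => ?_⟩
    have := h₃ i j
    rw [hl i, hl j] at this
    field_simp
    linear_combination this
  by_cases hm0 : m = 0
  · right
    intro a b
    refine ⟨h₁ a b, h₂ a b, ?_⟩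
    rw [hm b, hl a, hm0]
    ring
  · left
    have hr : ∀ j, r j = r i / p i * p j := by
      intro j
      have := h₂ i j
      rw [hm i, hm j] at this
      have h4 : r i * p j = r j * p i := by
        apply mul_left_cancel₀ hm0
        linear_combination this
      field_simp
      linear_combination -h4
    refine ⟨p, 1, l, r i / p i, l * (r i / p i) + m, fun j => by ring, hl, hr, fun j => ?_⟩
    rw [hm j, hr j]
    ring

lemma dichotomy (p q r w : Fin 3 → ℂ) (h₁ : ∀ i j, p i * q j = p j * q i)
    (h₂ : ∀ i j, r i * w j = r j * w i)
    (h₃ : ∀ i j, p i * w j - p j * w i + r i * q j - r j * q i = 0) :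
    RankI p q r w ∨ RankJ p q r w := by
  by_cases hp : ∃ i, p i ≠ 0
  · obtain ⟨i, hi⟩ := hp
    rcases dichotomy_aux p q r w h₁ h₂ h₃ i hi with ⟨n, c₁, c₂, c₃, c₄, k₁, k₂, k₃, k₄⟩ | h
    · exact Or.inl (rankI_of p q r w n c₁ c₂ c₃ c₄ k₁ k₂ k₃ k₄)
    · exact Or.inr h
  by_cases hq : ∃ i, q i ≠ 0
  · obtain ⟨i, hi⟩ := hq
    rcases dichotomy_aux q p w r (fun a b => by linear_combination -h₁ a b)
      (fun a b => by linear_combination -h₂ a b)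
      (fun a b => by linear_combination -h₃ a b) i hi with ⟨n, c₁, c₂, c₃, c₄, k₁, k₂, k₃, k₄⟩ | h
    · exact Or.inl (rankI_of p q r w n c₂ c₁ c₄ c₃ k₂ k₁ k₄ k₃)
    · exact Or.inr fun a b => ⟨h₁ a b, h₂ a b, (h a b).2.2.symm⟩
  push Not at hp hq
  right
  intro a b
  simp [hp, hq, h₂ a b]

/-- An alternating function on pairs of `Fin 3` vanishes if it does on the three basic pairs. -/
lemma alt_vanish (F : Fin 3 → Fin 3 → ℂ) (h : ∀ i j, F i j = -F j i) (h01 : F 0 1 = 0)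
    (h02 : F 0 2 = 0) (h12 : F 1 2 = 0) (i j : Fin 3) : F i j = 0 := by
  have hd : ∀ i, F i i = 0 := fun i => self_eq_neg.mp (h i i)
  fin_cases i <;> fin_cases j
  · exact hd 0
  · exact h01
  · exact h02
  · exact (h 1 0).trans (by rw [h01, neg_zero])
  · exact hd 1
  · exact h12
  · exact (h 2 0).trans (by rw [h02, neg_zero])
  · exact (h 2 1).trans (by rw [h12, neg_zero])
  · exact hd 2

set_option maxHeartbeats 1000000 in
/-- Proposition 2.5 (Table 2, row (f)): the degree-2 part of the ideal of the tangent cone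
at a type (f) matrix is the degree-2 part of the intersection of the two determinantal ideals,
and these quadrics vanish on tangent directions admitting a lift to a `2`-jet inside the locus
of skew matrices with vanishing Pfaffian. -/
theorem tangent_cone_quadrics_type_f
    (M M' M'' : Matrix (Fin 6) (Fin 6) Rp)
    (hM : M = !![0, 0, 0, 0, X 0, X 1;
                 0, 0, 0, -X 0, 0, X 2;
                 0, 0, 0, -X 1, -X 2, 0;
                 0, X 0, X 1, 0, 0, 0;
                 -X 0, 0, X 2, 0, 0, 0;
                 -X 1, -X 2, 0, 0, 0, 0])
    (hskew' : M'ᵀ = -M') (hlin' : ∀ i j, (M' i j).IsHomogeneous 1)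
    (hskew'' : M''ᵀ = -M'') (hlin'' : ∀ i j, (M'' i j).IsHomogeneous 1)
    (a : Fin 6 → Fin 6 → Fin 5 → ℂ)
    (ha : ∀ i j : Fin 6, i < j → M' i j = ∑ k : Fin 5, MvPolynomial.C (a i j k) * X k)
    -- the 3×4 matrix (Ñ₁ | Ñ₂) in the variables u_{ijk}
    (P : Matrix (Fin 3) (Fin 4) (MvPolynomial (Fin 6 × Fin 6 × Fin 5) ℂ))
    (hP : P = !![X (1, 2, 4), X (4, 5, 4), X (1, 2, 3), X (4, 5, 3);
                 X (0, 2, 4), X (3, 5, 4), X (0, 2, 3), X (3, 5, 3);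
                 X (0, 1, 4), X (3, 4, 4), X (0, 1, 3), X (3, 4, 3)])
    -- the 6×2 matrix obtained by stacking Ñ₁ on top of Ñ₂
    (Q : Matrix (Fin 6) (Fin 2) (MvPolynomial (Fin 6 × Fin 6 × Fin 5) ℂ))
    (hQ : Q = !![X (1, 2, 4), X (4, 5, 4);
                 X (0, 2, 4), X (3, 5, 4);
                 X (0, 1, 4), X (3, 4, 4);
                 X (1, 2, 3), X (4, 5, 3);
                 X (0, 2, 3), X (3, 5, 3);
                 X (0, 1, 3), X (3, 4, 3)])
    (I : Ideal (MvPolynomial (Fin 6 × Fin 6 × Fin 5) ℂ))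
    (hI : I = Ideal.span {m | ∃ (i₀ i₁ : Fin 3) (j₀ j₁ : Fin 4), i₀ < i₁ ∧ j₀ < j₁ ∧
      m = P i₀ j₀ * P i₁ j₁ - P i₀ j₁ * P i₁ j₀})
    (J : Ideal (MvPolynomial (Fin 6 × Fin 6 × Fin 5) ℂ))
    (hJ : J = Ideal.span {m | ∃ i₀ i₁ : Fin 6, i₀ < i₁ ∧
      m = Q i₀ 0 * Q i₁ 1 - Q i₀ 1 * Q i₁ 0})
    (hjet : pf (jet2 M M' M'') = 0) :
    ∀ g ∈ I ⊓ J, g.IsHomogeneous 2 →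
      MvPolynomial.eval (fun p : Fin 6 × Fin 6 × Fin 5 => a p.1 p.2.1 p.2.2) g = 0 := by
  intro g hg _
  subst hM
  have e1 := order_one M' M'' hjet
  have e2 := order_two M' M'' hjet
  have ev : ∀ i j : Fin 6, i < j → ∀ x : Fin 5 → ℂ, eval x (M' i j) = ∑ k, a i j k * x k := by
    intro i j hij x
    rw [ha i j hij]
    simp
  have sk := quad_vanish (a 0 3) (a 1 4) (a 2 5) (fun k => a 0 4 k + a 1 3 k)
    (fun k => a 0 5 k + a 2 3 k) (fun k => a 1 5 k + a 2 4 k) (by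
      intro x
      have := congrArg (eval x) e1
      simp only [map_add, map_sub, map_mul, map_pow, eval_X, map_zero] at this
      rw [ev 0 3 (by decide), ev 1 4 (by decide), ev 2 5 (by decide), ev 0 4 (by decide),
        ev 1 3 (by decide), ev 0 5 (by decide), ev 2 3 (by decide), ev 1 5 (by decide),
        ev 2 4 (by decide)] at this
      simp only [add_mul, Finset.sum_add_distrib]
      exact this)
  obtain ⟨s1, s2, s3, s4, s5, s6⟩ := sk 3 (by decide)
  obtain ⟨t1, t2, t3, t4, t5, t6⟩ := sk 4 (by decide)
  have s4' : a 1 3 3 = - a 0 4 3 := by linear_combination s4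
  have s5' : a 2 3 3 = - a 0 5 3 := by linear_combination s5
  have s6' : a 2 4 3 = - a 1 5 3 := by linear_combination s6
  have t4' : a 1 3 4 = - a 0 4 4 := by linear_combination t4
  have t5' : a 2 3 4 = - a 0 5 4 := by linear_combination t5
  have t6' : a 2 4 4 = - a 1 5 4 := by linear_combination t6
  have fo := first_order _ _ _ _ _ _ _ _ _ _ rfl e2
  have ev2 : ∀ i j : Fin 6, i < j → ∀ s t : ℂ,
      eval ![0, 0, 0, s, t] (M' i j) = a i j 3 * s + a i j 4 * t := by
    intro i j hij s t
    rw [ev i j hij]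
    simp [Fin.sum_univ_five]
  simp only [map_add, map_sub, map_mul] at fo
  simp only [ev2 0 1 (by decide), ev2 0 2 (by decide), ev2 0 3 (by decide), ev2 0 4 (by decide),
    ev2 0 5 (by decide), ev2 1 2 (by decide), ev2 1 3 (by decide), ev2 1 4 (by decide),
    ev2 1 5 (by decide), ev2 2 3 (by decide), ev2 2 4 (by decide), ev2 2 5 (by decide),
    ev2 3 4 (by decide), ev2 3 5 (by decide), ev2 4 5 (by decide),
    s1, s2, s3, s4', s5', s6', t1, t2, t3, t4', t5', t6'] at fo
  obtain ⟨f1, f2, f3⟩ := fo 1 0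
  obtain ⟨g1, g2, g3⟩ := fo 0 1
  obtain ⟨k1, k2, k3⟩ := fo 1 1
  ring_nf at f1 f2 f3 g1 g2 g3 k1 k2 k3
  have dich := dichotomy ![a 1 2 3, a 0 2 3, a 0 1 3] ![a 4 5 3, a 3 5 3, a 3 4 3]
    ![a 1 2 4, a 0 2 4, a 0 1 4] ![a 4 5 4, a 3 5 4, a 3 4 4]
    (fun i j => sub_eq_zero.mp (alt_vanish (fun i j => ![a 1 2 3, a 0 2 3, a 0 1 3] i *
        ![a 4 5 3, a 3 5 3, a 3 4 3] j - ![a 1 2 3, a 0 2 3, a 0 1 3] j *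
        ![a 4 5 3, a 3 5 3, a 3 4 3] i) (fun i j => by ring)
      (by simp; linear_combination -f1) (by simp; linear_combination f2)
      (by simp; linear_combination -f3) i j))
    (fun i j => sub_eq_zero.mp (alt_vanish (fun i j => ![a 1 2 4, a 0 2 4, a 0 1 4] i *
        ![a 4 5 4, a 3 5 4, a 3 4 4] j - ![a 1 2 4, a 0 2 4, a 0 1 4] j *
        ![a 4 5 4, a 3 5 4, a 3 4 4] i) (fun i j => by ring)
      (by simp; linear_combination -g1) (by simp; linear_combination g2)
      (by simp; linear_combination -g3) i j))
    (alt_vanish _ (fun i j => by ring)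
      (by simp; linear_combination -k1 + f1 + g1) (by simp; linear_combination k2 - f2 - g2)
      (by simp; linear_combination -k3 + f3 + g3))
  set e : MvPolynomial (Fin 6 × Fin 6 × Fin 5) ℂ →+* ℂ :=
    MvPolynomial.eval (fun p : Fin 6 × Fin 6 × Fin 5 => a p.1 p.2.1 p.2.2) with he
  have heX : ∀ i j k, e (X (i, j, k)) = a i j k := by
    intro i j k
    simp [he]
  rcases dich with hr | hr
  · have hle : I ≤ RingHom.ker e := by
      rw [hI, Ideal.span_le]
      rintro m ⟨i₀, i₁, j₀, j₁, -, -, rfl⟩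
      have hv : ∀ i j, e (P i j) = (![![a 1 2 4, a 0 2 4, a 0 1 4], ![a 4 5 4, a 3 5 4, a 3 4 4],
          ![a 1 2 3, a 0 2 3, a 0 1 3], ![a 4 5 3, a 3 5 3, a 3 4 3]] j) i := by
        intro i j
        rw [hP]
        fin_cases i <;> fin_cases j <;> exact heX _ _ _
      rw [SetLike.mem_coe, RingHom.mem_ker, map_sub, map_mul, map_mul, hv, hv, hv, hv,
        hr j₀ j₁ i₀ i₁, sub_self]
    exact hle hg.1
  · have hle : J ≤ RingHom.ker e := by
      rw [hJ, Ideal.span_le]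
      rintro m ⟨i₀, i₁, hlt, rfl⟩
      have hv : ∀ i, (∃ k : Fin 3, e (Q i 0) = ![a 1 2 3, a 0 2 3, a 0 1 3] k ∧
          e (Q i 1) = ![a 4 5 3, a 3 5 3, a 3 4 3] k) ∨
          (∃ k : Fin 3, e (Q i 0) = ![a 1 2 4, a 0 2 4, a 0 1 4] k ∧
          e (Q i 1) = ![a 4 5 4, a 3 5 4, a 3 4 4] k) := by
        intro i
        rw [hQ]
        fin_cases i
        · exact Or.inr ⟨0, heX _ _ _, heX _ _ _⟩
        · exact Or.inr ⟨1, heX _ _ _, heX _ _ _⟩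
        · exact Or.inr ⟨2, heX _ _ _, heX _ _ _⟩
        · exact Or.inl ⟨0, heX _ _ _, heX _ _ _⟩
        · exact Or.inl ⟨1, heX _ _ _, heX _ _ _⟩
        · exact Or.inl ⟨2, heX _ _ _, heX _ _ _⟩
      rw [SetLike.mem_coe, RingHom.mem_ker, map_sub, map_mul, map_mul]
      rcases hv i₀ with ⟨k, u₀, u₁⟩ | ⟨k, u₀, u₁⟩ <;> rcases hv i₁ with ⟨l, v₀, v₁⟩ | ⟨l, v₀, v₁⟩ <;>
        rw [u₀, u₁, v₀, v₁]
      · linear_combination (hr k l).1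
      · linear_combination (hr k l).2.2
      · linear_combination -(hr l k).2.2
      · linear_combination (hr k l).2.1
    exact hle hg.2
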